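/- arXiv:1806.00176 — 2 statements merged into one kernel-verified Lean document; each statement's English description precedes it below -/
import Mathlib

section
/- Let φ(z) = (1/√(2π))·exp(−z²/2), let c₁, c₂ > 0, and define ELBO(θ) = ∫_ℝ φ(z−θ)·log(r(z)/φ(z−θ)) dz where r(z) = 𝟙{z>0}·c₁·φ(z) + 𝟙{z≤0}·c₂·φ(z). Then for every θ ∈ ℝ, ELBO(θ) = (1/2)·(−θ² + erf(θ/√2)·log(c₁/c₂) + log(c₁·c₂)), where erf(x) = (2/√π)·∫₀ˣ exp(−t²) dt. -/
open MeasureTheory Real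

/-- The standard normal density. -/
noncomputable def stdNormal (z : ℝ) : ℝ :=
  (1 / Real.sqrt (2 * Real.pi)) * Real.exp (-z ^ 2 / 2)

/-- The unnormalized posterior `r(z) = 𝟙{z>0}·c₁·φ(z) + 𝟙{z≤0}·c₂·φ(z)`. -/
noncomputable def rPost (c₁ c₂ : ℝ) (z : ℝ) : ℝ :=
  (if z > 0 then (1 : ℝ) else 0) * c₁ * stdNormal z +
  (if z ≤ 0 then (1 : ℝ) else 0) * c₂ * stdNormal z

/-- `ELBO(θ) = ∫ φ(z−θ)·log(r(z)/φ(z−θ)) dz`. -/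
noncomputable def elbo (c₁ c₂ : ℝ) (θ : ℝ) : ℝ :=
  ∫ z : ℝ, stdNormal (z - θ) * Real.log (rPost c₁ c₂ z / stdNormal (z - θ))

/-- The error function `erf(x) = (2/√π)·∫₀ˣ exp(−t²) dt`. -/
noncomputable def erf (x : ℝ) : ℝ :=
  (2 / Real.sqrt Real.pi) * ∫ t in (0 : ℝ)..x, Real.exp (-t ^ 2)

lemma stdNormal_eq (z : ℝ) :
    stdNormal z = (1 / √(2 * π)) * Real.exp (-(1 / 2) * z ^ 2) := by
  rw [stdNormal]
  congr 2
  ring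

lemma stdNormal_pos (z : ℝ) : 0 < stdNormal z := by
  unfold stdNormal
  positivity

lemma stdNormal_neg (z : ℝ) : stdNormal (-z) = stdNormal z := by
  simp [stdNormal]

lemma integrable_stdNormal : Integrable stdNormal := by
  simp_rw [funext stdNormal_eq]
  exact (integrable_exp_neg_mul_sq (by norm_num)).const_mul _

lemma integrable_mul_stdNormal : Integrable fun z ↦ z * stdNormal z := by
  have h := (integrable_mul_exp_neg_mul_sq (b := 1 / 2) (by norm_num)).const_mul (1 / √(2 * π))
  refine h.congr (.of_forall fun z ↦ ?_)
  simp only [stdNormal_eq]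
  ring

lemma integral_stdNormal : ∫ z, stdNormal z = 1 := by
  simp_rw [stdNormal_eq]
  rw [integral_const_mul, integral_gaussian, show π / (1 / 2) = 2 * π by ring]
  exact one_div_mul_cancel (by positivity)

lemma integral_mul_stdNormal : ∫ z, z * stdNormal z = 0 := by
  have h := integral_neg_eq_self (fun z ↦ z * stdNormal z) volume
  simp only [stdNormal_neg, neg_mul, integral_neg] at h
  linarith

lemma setIntegral_Ioi_zero_stdNormal : ∫ z in Set.Ioi 0, stdNormal z = 1 / 2 := by
  simp_rw [stdNormal_eq]
  rw [integral_const_mul, integral_gaussian_Ioi, show π / (1 / 2) = 2 * π by ring]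
  field_simp

lemma intervalIntegral_stdNormal (x : ℝ) :
    ∫ z in (0 : ℝ)..x, stdNormal z = erf (x / √2) / 2 := by
  have h := intervalIntegral.integral_comp_div (a := 0) (b := x)
    (fun t ↦ Real.exp (-t ^ 2)) (c := √2) (by positivity)
  simp only [zero_div, smul_eq_mul, div_pow, Real.sq_sqrt (zero_le_two : (0 : ℝ) ≤ 2)] at h
  have hs : √2 * √2 = 2 := Real.mul_self_sqrt zero_le_two
  simp only [stdNormal, neg_div]
  rw [intervalIntegral.integral_const_mul, h, erf, Real.sqrt_mul zero_le_two]
  field_simp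

lemma setIntegral_Ioi_neg_stdNormal (x : ℝ) :
    ∫ z in Set.Ioi (-x), stdNormal z = 1 / 2 + erf (x / √2) / 2 := by
  have h := intervalIntegral.integral_interval_add_Ioi (a := -x) (b := 0)
    integrable_stdNormal.integrableOn integrable_stdNormal.integrableOn
  have hn := intervalIntegral.integral_comp_neg (a := 0) (b := x) stdNormal
  simp only [stdNormal_neg, neg_zero] at hn
  rw [← h, ← hn, intervalIntegral_stdNormal, setIntegral_Ioi_zero_stdNormal, add_comm]

lemma log_mul_stdNormal_div_stdNormal {c : ℝ} (hc : 0 < c) (z θ : ℝ) :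
    Real.log (c * stdNormal (z + θ) / stdNormal z) = Real.log c - θ * z - θ ^ 2 / 2 := by
  have h : stdNormal (z + θ) / stdNormal z = Real.exp (-θ * z - θ ^ 2 / 2) := by
    rw [div_eq_iff (stdNormal_pos z).ne', stdNormal, stdNormal, mul_left_comm, ← Real.exp_add]
    congr 2
    ring
  rw [mul_div_assoc, h, Real.log_mul hc.ne' (Real.exp_ne_zero _), Real.log_exp]
  ring

lemma stdNormal_mul_log_rPost {c₁ c₂ : ℝ} (hc₁ : 0 < c₁) (hc₂ : 0 < c₂) (z θ : ℝ) :
    stdNormal z * Real.log (rPost c₁ c₂ (z + θ) / stdNormal z) =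
      (Real.log c₂ - θ ^ 2 / 2) * stdNormal z - θ * (z * stdNormal z) +
        (Real.log c₁ - Real.log c₂) * (Set.Ioi (-θ)).indicator stdNormal z := by
  by_cases hz : 0 < z + θ
  · have hm : z ∈ Set.Ioi (-θ) := neg_lt_iff_pos_add.2 hz
    have hr : rPost c₁ c₂ (z + θ) = c₁ * stdNormal (z + θ) := by
      simp [rPost, hz, hz.not_ge]
    rw [Set.indicator_of_mem hm, hr, log_mul_stdNormal_div_stdNormal hc₁]
    ring
  · have hm : z ∉ Set.Ioi (-θ) := fun h ↦ hz (neg_lt_iff_pos_add.1 h)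
    have hr : rPost c₁ c₂ (z + θ) = c₂ * stdNormal (z + θ) := by
      simp [rPost, hz, not_lt.1 hz]
    rw [Set.indicator_of_notMem hm, hr, log_mul_stdNormal_div_stdNormal hc₂]
    ring

theorem elbo_closed_form (c₁ c₂ : ℝ) (hc₁ : 0 < c₁) (hc₂ : 0 < c₂) (θ : ℝ) :
    elbo c₁ c₂ θ =
      (1 / 2) * (-θ ^ 2 + erf (θ / Real.sqrt 2) * Real.log (c₁ / c₂)
        + Real.log (c₁ * c₂)) := by
  have hshift : elbo c₁ c₂ θ =
      ∫ z, stdNormal z * Real.log (rPost c₁ c₂ (z + θ) / stdNormal z) := by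
    rw [elbo, ← integral_add_right_eq_self _ θ]
    simp only [add_sub_cancel_right]
  have h₁ := integrable_stdNormal.const_mul (Real.log c₂ - θ ^ 2 / 2)
  have h₂ := integrable_mul_stdNormal.const_mul θ
  have h₃ := (integrable_stdNormal.indicator (measurableSet_Ioi (a := -θ))).const_mul
    (Real.log c₁ - Real.log c₂)
  simp_rw [hshift, stdNormal_mul_log_rPost hc₁ hc₂]
  rw [integral_add (by exact h₁.sub h₂) h₃, integral_sub h₁ h₂, integral_const_mul, integral_const_mul,
    integral_const_mul, integral_indicator measurableSet_Ioi, integral_stdNormal,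
    integral_mul_stdNormal, setIntegral_Ioi_neg_stdNormal, Real.log_div hc₁.ne' hc₂.ne',
    Real.log_mul hc₁.ne' hc₂.ne']
  ring
end

section
/- Let φ(z) = (1/√(2π))·exp(−z²/2), let c₁, c₂ > 0, define ELBO(θ) = ∫_ℝ φ(z−θ)·log(r(z)/φ(z−θ)) dz where r(z) = 𝟙{z>0}·c₁·φ(z) + 𝟙{z≤0}·c₂·φ(z), and define Reparam(θ) = ∫_ℝ φ(ε)·(𝟙{ε+θ>0}·(−θ−ε) + 𝟙{ε+θ≤0}·(−θ−ε)) dε. Then for every θ ∈ ℝ, ELBO′(θ) = Reparam(θ) + φ(θ)·log(c₁/c₂); i.e., the exact gradient equals the region-wise reparameterization term plus the boundary correction term q(−θ)·(h₁(−θ,θ) − h₂(−θ,θ)) = φ(θ)·log(c₁/c₂), where h_k(ε,θ) = −θ²/2 − εθ + log c_k. -/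
open MeasureTheory Real

/-- The naive reparameterization gradient. -/
noncomputable def reparam (θ : ℝ) : ℝ :=
  ∫ ε : ℝ, stdNormal ε *
    ((if ε + θ > 0 then (1 : ℝ) else 0) * (-θ - ε) +
     (if ε + θ ≤ 0 then (1 : ℝ) else 0) * (-θ - ε))

/-- `h_k(ε,θ) = −θ²/2 − εθ + log c_k`. -/
noncomputable def hBranch (c : ℝ) (ε θ : ℝ) : ℝ := -θ ^ 2 / 2 - ε * θ + Real.log c

lemma stdNormal_eq_gaussianPDFReal : stdNormal = ProbabilityTheory.gaussianPDFReal 0 1 := by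
  ext z
  simp [stdNormal, ProbabilityTheory.gaussianPDFReal]

lemma continuous_stdNormal : Continuous stdNormal := by
  unfold stdNormal
  fun_prop

lemma integrable_stdNormal_mul_id : Integrable fun z => stdNormal z * z := by
  refine ((integrable_mul_exp_neg_mul_sq (b := 1 / 2) (by norm_num)).const_mul
    (1 / Real.sqrt (2 * Real.pi))).congr (.of_forall fun z => ?_)
  simp only [stdNormal]
  rw [show -(1 / 2) * z ^ 2 = -z ^ 2 / 2 by ring]
  ring

lemma integral_stdNormal_mul_id : ∫ z, stdNormal z * z = 0 := by
  have h := integral_neg_eq_self (fun z => stdNormal z * z) volume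
  simp only [stdNormal_neg, mul_neg, integral_neg] at h
  linarith

lemma integral_stdNormal_mul_affine (a b : ℝ) :
    ∫ z, (a * stdNormal z + b * (stdNormal z * z)) = a := by
  rw [integral_add (integrable_stdNormal.const_mul a) (integrable_stdNormal_mul_id.const_mul b),
    integral_const_mul, integral_const_mul, integral_stdNormal, integral_stdNormal_mul_id]
  ring

lemma reparam_eq (θ : ℝ) : reparam θ = -θ := by
  rw [← integral_stdNormal_mul_affine (-θ) (-1), reparam]
  congr with z
  rcases lt_or_ge 0 (z + θ) with h | h
  · simp only [gt_iff_lt, h, not_le.2 h, if_true, if_false]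
    ring
  · simp only [gt_iff_lt, h, not_lt.2 h, if_true, if_false]
    ring

lemma log_mul_stdNormal_div {c : ℝ} (hc : 0 < c) (ε θ : ℝ) :
    Real.log (c * stdNormal (ε + θ) / stdNormal ε) = hBranch c ε θ := by
  have h : c * stdNormal (ε + θ) / stdNormal ε = c * Real.exp (-θ ^ 2 / 2 - ε * θ) := by
    rw [div_eq_iff (stdNormal_pos ε).ne', stdNormal, stdNormal,
      show -(ε + θ) ^ 2 / 2 = (-θ ^ 2 / 2 - ε * θ) + -ε ^ 2 / 2 by ring, Real.exp_add]
    ring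
  rw [h, Real.log_mul hc.ne' (Real.exp_ne_zero _), Real.log_exp, hBranch]
  ring

lemma log_rPost_div {c₁ c₂ : ℝ} (hc₁ : 0 < c₁) (hc₂ : 0 < c₂) (ε θ : ℝ) :
    Real.log (rPost c₁ c₂ (ε + θ) / stdNormal ε) =
      if ε + θ > 0 then hBranch c₁ ε θ else hBranch c₂ ε θ := by
  split_ifs with h
  · simp [rPost, h, not_le.2 h, log_mul_stdNormal_div hc₁]
  · simp [rPost, h, not_lt.1 h, log_mul_stdNormal_div hc₂]

lemma elbo_eq {c₁ c₂ : ℝ} (hc₁ : 0 < c₁) (hc₂ : 0 < c₂) (θ : ℝ) :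
    elbo c₁ c₂ θ = -θ ^ 2 / 2 + Real.log c₂ +
      Real.log (c₁ / c₂) * ∫ z in Set.Iic θ, stdNormal z := by
  have hflip : ∫ z in Set.Iic θ, stdNormal z = ∫ z in Set.Ioi (-θ), stdNormal z := by
    rw [← integral_comp_neg_Iic]
    simp only [stdNormal_neg]
  rw [elbo, ← integral_add_right_eq_self _ θ, hflip, ← integral_indicator measurableSet_Ioi,
    ← integral_const_mul, ← integral_stdNormal_mul_affine (-θ ^ 2 / 2 + Real.log c₂) (-θ),
    ← integral_add (by
        exact (integrable_stdNormal.const_mul _).add (integrable_stdNormal_mul_id.const_mul _))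
      ((integrable_stdNormal.indicator measurableSet_Ioi).const_mul _)]
  congr with ε
  rw [add_sub_cancel_right, log_rPost_div hc₁ hc₂, Real.log_div hc₁.ne' hc₂.ne',
    Set.indicator_apply, hBranch, hBranch]
  simp only [Set.mem_Ioi, neg_lt_iff_pos_add, gt_iff_lt]
  split_ifs <;> ring

lemma hasDerivAt_integral_Iic_stdNormal (θ : ℝ) :
    HasDerivAt (fun t => ∫ z in Set.Iic t, stdNormal z) (stdNormal θ) θ := by
  have h (t : ℝ) : ∫ z in Set.Iic t, stdNormal z =
      (∫ z in Set.Iic (0 : ℝ), stdNormal z) + ∫ z in (0 : ℝ)..t, stdNormal z := by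
    rw [← intervalIntegral.integral_Iic_sub_Iic integrable_stdNormal.integrableOn
      integrable_stdNormal.integrableOn]
    ring
  rw [funext h]
  exact (continuous_stdNormal.integral_hasStrictDerivAt 0 θ).hasDerivAt.const_add _

lemma hasDerivAt_elbo {c₁ c₂ : ℝ} (hc₁ : 0 < c₁) (hc₂ : 0 < c₂) (θ : ℝ) :
    HasDerivAt (elbo c₁ c₂) (reparam θ + stdNormal θ * Real.log (c₁ / c₂)) θ := by
  rw [funext (elbo_eq hc₁ hc₂), reparam_eq]
  have h := ((((hasDerivAt_id θ).pow 2).neg.div_const 2).add_const (Real.log c₂)).add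
    ((hasDerivAt_integral_Iic_stdNormal θ).const_mul (Real.log (c₁ / c₂)))
  refine h.congr_deriv ?_
  simp
  ring

theorem elbo_deriv_eq_reparam_plus_boundary
    (c₁ c₂ : ℝ) (hc₁ : 0 < c₁) (hc₂ : 0 < c₂) (θ : ℝ) :
    deriv (elbo c₁ c₂) θ = reparam θ + stdNormal θ * Real.log (c₁ / c₂) ∧
    stdNormal (-θ) * (hBranch c₁ (-θ) θ - hBranch c₂ (-θ) θ)
      = stdNormal θ * Real.log (c₁ / c₂) := by
  refine ⟨(hasDerivAt_elbo hc₁ hc₂ θ).deriv, ?_⟩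
  rw [stdNormal_neg, hBranch, hBranch, Real.log_div hc₁.ne' hc₂.ne']
  ring
end
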